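/- arXiv:1803.03207 — 2 statements merged into one kernel-verified Lean document; each statement's English description precedes it below -/
import Mathlib

section
/- Let α > 0, r > 0, and let p ∈ (2, ∞). Let q′ denote the conjugate exponent of p/2 (i.e. 2/p + 1/q′ = 1). Let F : (0,r) → ℝ be measurable with F(s) ≥ 0 a.e. and F ∈ L^p(0,r), and let h : (0,r) → ℝ be measurable with h(s) ≥ 0 a.e. and ∫₀^r e^{α(s−r)} h(s)² ds < ∞. Then ∫₀^r e^{α(s−r)} F(s) h(s) ds ≤ ((1 − e^{−q′αr})/(q′α))^{1/(2q′)} · ‖F‖_{L^p(0,r)} · ( ∫₀^r e^{α(s−r)} h(s)² ds )^{1/2}. -/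
open MeasureTheory Real Set Filter

/-- A nonnegative function whose `p`-th power is integrable belongs to `L^p`. -/
lemma memLp_ofReal_of_integrable_rpow {X : Type*} [MeasurableSpace X] {μ : Measure X}
    {f : X → ℝ} {p : ℝ} (hp : 0 < p) (hf : AEStronglyMeasurable f μ) (hf0 : 0 ≤ᵐ[μ] f)
    (hfp : Integrable (fun x => f x ^ p) μ) : MemLp f (ENNReal.ofReal p) μ := by
  rw [← integrable_norm_rpow_iff hf (by simpa using hp) ENNReal.ofReal_ne_top,
    ENNReal.toReal_ofReal hp.le]
  refine hfp.congr ?_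
  filter_upwards [hf0] with x hx
  rw [Real.norm_of_nonneg hx]

lemma integral_Ioo_exp_mul_sub {c r : ℝ} (hc : c ≠ 0) (hr : 0 ≤ r) :
    ∫ s in Set.Ioo 0 r, Real.exp (c * (s - r)) = (1 - Real.exp (-(c * r))) / c := by
  rw [← integral_Ioc_eq_integral_Ioo, ← intervalIntegral.integral_of_le hr]
  have hderiv (s : ℝ) :
      HasDerivAt (fun s => Real.exp (c * (s - r)) / c) (Real.exp (c * (s - r))) s := by
    refine ((((hasDerivAt_id s).sub_const r).const_mul c).exp.div_const c).congr_deriv ?_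
    rw [mul_one, mul_div_cancel_right₀ _ hc, id]
  rw [intervalIntegral.integral_eq_sub_of_hasDerivAt (fun s _ => hderiv s)
    (Continuous.intervalIntegrable (by fun_prop) _ _)]
  simp [sub_div]

/-- Weighted Cauchy–Schwarz inequality, followed by Hölder's inequality with exponents `q` and
`p / 2` applied to the weight and to the square of the first function. -/
lemma integral_weight_mul_mul_le {X : Type*} [MeasurableSpace X] {μ : Measure X}
    {w F h : X → ℝ} {p q : ℝ} (hpq : q.HolderConjugate (p / 2))
    (hw : AEStronglyMeasurable w μ) (hF : AEStronglyMeasurable F μ)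
    (hh : AEStronglyMeasurable h μ)
    (hw0 : 0 ≤ᵐ[μ] w) (hF0 : 0 ≤ᵐ[μ] F) (hh0 : 0 ≤ᵐ[μ] h)
    (hwq : Integrable (fun x => w x ^ q) μ) (hFp : Integrable (fun x => F x ^ p) μ)
    (hwh : Integrable (fun x => w x * h x ^ 2) μ) :
    ∫ x, w x * F x * h x ∂μ ≤
      (∫ x, w x ^ q ∂μ) ^ (1 / (2 * q)) * (∫ x, F x ^ p ∂μ) ^ (1 / p) *
        (∫ x, w x * h x ^ 2 ∂μ) ^ ((1 : ℝ) / 2) := by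
  have hq : 0 < q := hpq.pos
  have hp : 0 < p / 2 := hpq.symm.pos
  have hFsq : (fun x => (F x ^ 2) ^ (p / 2)) =ᵐ[μ] fun x => F x ^ p := by
    filter_upwards [hF0] with x hx
    rw [← Real.rpow_natCast_mul hx]
    congr 1
    push_cast
    ring
  have hF2 : 0 ≤ᵐ[μ] fun x => F x ^ 2 := Eventually.of_forall fun x => sq_nonneg _
  have hwL : MemLp w (ENNReal.ofReal q) μ := memLp_ofReal_of_integrable_rpow hq hw hw0 hwq
  have hFL : MemLp (fun x => F x ^ 2) (ENNReal.ofReal (p / 2)) μ :=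
    memLp_ofReal_of_integrable_rpow hp (hF.pow 2) hF2 (hFp.congr hFsq.symm)
  have hwF : Integrable (fun x => w x * F x ^ 2) μ := by
    have := hpq.ennrealOfReal
    exact hwL.integrable_mul hFL
  have holder := integral_mul_le_Lp_mul_Lq_of_nonneg hpq hw0 hF2 hwL hFL
  rw [integral_congr_ae hFsq] at holder
  have hs : AEStronglyMeasurable (fun x => √(w x)) μ :=
    Real.continuous_sqrt.comp_aestronglyMeasurable hw
  have sq_weight (g : X → ℝ) :
      (fun x => (√(w x) * g x) ^ (2 : ℝ)) =ᵐ[μ] fun x => w x * g x ^ 2 := by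
    filter_upwards [hw0] with x hx
    rw [Real.rpow_two, mul_pow, Real.sq_sqrt hx]
  have weight_nonneg {g : X → ℝ} (hg : 0 ≤ᵐ[μ] g) : 0 ≤ᵐ[μ] fun x => √(w x) * g x := by
    filter_upwards [hg] with x hx
    exact mul_nonneg (Real.sqrt_nonneg _) hx
  have cauchy := integral_mul_le_Lp_mul_Lq_of_nonneg Real.HolderConjugate.two_two
    (weight_nonneg hF0) (weight_nonneg hh0)
    (memLp_ofReal_of_integrable_rpow two_pos (hs.mul hF) (weight_nonneg hF0)
      (hwF.congr (sq_weight F).symm))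
    (memLp_ofReal_of_integrable_rpow two_pos (hs.mul hh) (weight_nonneg hh0)
      (hwh.congr (sq_weight h).symm))
  rw [integral_congr_ae (sq_weight F), integral_congr_ae (sq_weight h)] at cauchy
  have hprod : ∫ x, w x * F x * h x ∂μ = ∫ x, √(w x) * F x * (√(w x) * h x) ∂μ := by
    refine integral_congr_ae ?_
    filter_upwards [hw0] with x hx
    rw [mul_mul_mul_comm, Real.mul_self_sqrt hx, mul_assoc]
  have hIw : 0 ≤ ∫ x, w x ^ q ∂μ := by
    refine integral_nonneg_of_ae ?_
    filter_upwards [hw0] with x hx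
    exact Real.rpow_nonneg hx q
  have hIF : 0 ≤ ∫ x, F x ^ p ∂μ := by
    refine integral_nonneg_of_ae ?_
    filter_upwards [hF0] with x hx
    exact Real.rpow_nonneg hx p
  have hIwF : 0 ≤ ∫ x, w x * F x ^ 2 ∂μ := by
    refine integral_nonneg_of_ae ?_
    filter_upwards [hw0] with x hx
    exact mul_nonneg hx (sq_nonneg _)
  have hIwh : 0 ≤ ∫ x, w x * h x ^ 2 ∂μ := by
    refine integral_nonneg_of_ae ?_
    filter_upwards [hw0] with x hx
    exact mul_nonneg hx (sq_nonneg _)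
  rw [hprod]
  refine cauchy.trans (mul_le_mul_of_nonneg_right ?_ (Real.rpow_nonneg hIwh _))
  refine (Real.rpow_le_rpow hIwF holder (by norm_num)).trans_eq ?_
  rw [Real.mul_rpow (Real.rpow_nonneg hIw _) (Real.rpow_nonneg hIF _), ← Real.rpow_mul hIw,
    ← Real.rpow_mul hIF]
  congr 2 <;> field_simp

/-- Exponentially weighted time accumulation estimate (4.2), case `p ∈ (2, ∞)`:
with `q′` the conjugate exponent of `p/2` (i.e. `2/p + 1/q′ = 1`), nonnegative `F ∈ L^p(0,r)`
and nonnegative `h` with `∫₀^r e^{α(s−r)} h(s)² ds < ∞`,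
`∫₀^r e^{α(s−r)} F h ds ≤ ((1 − e^{−q′αr})/(q′α))^{1/(2q′)} ‖F‖_{L^p} (∫₀^r e^{α(s−r)} h² ds)^{1/2}`. -/
theorem stmt_3 (α r p q' : ℝ) (hα : 0 < α) (hr : 0 < r) (hp : 2 < p)
    (hpq : 2 / p + 1 / q' = 1)
    (F h : ℝ → ℝ) (hFmeas : Measurable F)
    (hFpos : ∀ᵐ s ∂(volume.restrict (Set.Ioo 0 r)), 0 ≤ F s)
    (hFLp : IntegrableOn (fun s => F s ^ p) (Set.Ioo 0 r))
    (hhmeas : Measurable h)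
    (hhpos : ∀ᵐ s ∂(volume.restrict (Set.Ioo 0 r)), 0 ≤ h s)
    (hhint : IntegrableOn (fun s => Real.exp (α * (s - r)) * h s ^ 2) (Set.Ioo 0 r)) :
    ∫ s in Set.Ioo 0 r, Real.exp (α * (s - r)) * F s * h s ≤
      ((1 - Real.exp (-(q' * α * r))) / (q' * α)) ^ (1 / (2 * q')) *
        (∫ s in Set.Ioo 0 r, F s ^ p) ^ (1 / p) *
        (∫ s in Set.Ioo 0 r, Real.exp (α * (s - r)) * h s ^ 2) ^ ((1 : ℝ) / 2) := by
  have hpq' : q'.HolderConjugate (p / 2) := by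
    refine (Real.holderConjugate_iff.mpr ⟨by linarith, ?_⟩).symm
    rw [inv_div, ← one_div q', hpq]
  have hexp : (fun s => Real.exp (α * (s - r)) ^ q') =
      fun s => Real.exp (q' * α * (s - r)) := by
    funext s
    rw [← Real.exp_mul]
    congr 1
    ring
  have hexp_cont : Continuous fun s => Real.exp (q' * α * (s - r)) := by fun_prop
  have key := integral_weight_mul_mul_le (w := fun s => Real.exp (α * (s - r))) hpq'
    (by fun_prop) hFmeas.aestronglyMeasurable hhmeas.aestronglyMeasurable
    (Eventually.of_forall fun s => (Real.exp_pos _).le) hFpos hhpos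
    (by
      rw [hexp]
      exact hexp_cont.integrableOn_Icc.mono_set Set.Ioo_subset_Icc_self)
    hFLp hhint
  rwa [hexp, integral_Ioo_exp_mul_sub (mul_pos hpq'.pos hα).ne' hr.le] at key
end

section
/- Let κ > 0, λ ∈ [0,1], r > 0, and set α = 2(1−λ)/κ². Let y : [0,r] → ℝ be continuous and nonnegative with y² continuously differentiable on [0,r], and let z, P, Q : [0,r] → ℝ be measurable and nonnegative with y(t) ≤ κ z(t) for all t, and suppose the functions s ↦ e^{α(s−r)} z(s)², s ↦ e^{α(s−r)} P(s) y(s), s ↦ e^{α(s−r)} Q(s) z(s) are integrable on (0,r). If (1/2)(y²)′(t) + z(t)² ≤ P(t) y(t) + Q(t) z(t) for a.e. t ∈ (0,r), then (1/2) y(r)² + λ ∫₀^r e^{α(s−r)} z(s)² ds ≤ (1/2) y(0)² + ∫₀^r e^{α(s−r)} ( P(s) y(s) + Q(s) z(s) ) ds. -/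
open MeasureTheory Real Set Filter

/-- Integrated exponentially weighted energy inequality from the proof of the parabolic
error estimate (Lemma 4.5): if `y ≤ κ z` on `[0,r]`, `α = 2(1−λ)/κ²`, and
`(1/2)(y²)′ + z² ≤ P y + Q z` a.e. on `(0,r)`, then
`(1/2)y(r)² + λ ∫₀^r e^{α(s−r)} z² ds ≤ (1/2)y(0)² + ∫₀^r e^{α(s−r)} (P y + Q z) ds`. -/
theorem stmt_10 (κ lam r : ℝ) (hκ : 0 < κ) (hlam : lam ∈ Set.Icc (0 : ℝ) 1) (hr : 0 < r)
    (α : ℝ) (hαdef : α = 2 * (1 - lam) / κ ^ 2)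
    (y z P Q w : ℝ → ℝ)
    (hycont : ContinuousOn y (Set.Icc 0 r))
    (hynn : ∀ t ∈ Set.Icc (0 : ℝ) r, 0 ≤ y t)
    (hw : ∀ t ∈ Set.Icc (0 : ℝ) r,
      HasDerivWithinAt (fun s => y s ^ 2) (w t) (Set.Icc 0 r) t)
    (hwcont : ContinuousOn w (Set.Icc 0 r))
    (hzmeas : Measurable z) (hPmeas : Measurable P) (hQmeas : Measurable Q)
    (hznn : ∀ t ∈ Set.Icc (0 : ℝ) r, 0 ≤ z t)
    (hPnn : ∀ t ∈ Set.Icc (0 : ℝ) r, 0 ≤ P t)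
    (hQnn : ∀ t ∈ Set.Icc (0 : ℝ) r, 0 ≤ Q t)
    (hyz : ∀ t ∈ Set.Icc (0 : ℝ) r, y t ≤ κ * z t)
    (hint1 : IntegrableOn (fun s => Real.exp (α * (s - r)) * z s ^ 2) (Set.Ioo 0 r))
    (hint2 : IntegrableOn (fun s => Real.exp (α * (s - r)) * (P s * y s)) (Set.Ioo 0 r))
    (hint3 : IntegrableOn (fun s => Real.exp (α * (s - r)) * (Q s * z s)) (Set.Ioo 0 r))
    (hode : ∀ᵐ t ∂(volume.restrict (Set.Ioo 0 r)),
      (1 / 2) * w t + z t ^ 2 ≤ P t * y t + Q t * z t) :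
    (1 / 2) * y r ^ 2 + lam * ∫ s in Set.Ioo 0 r, Real.exp (α * (s - r)) * z s ^ 2 ≤
      (1 / 2) * y 0 ^ 2 +
        ∫ s in Set.Ioo 0 r, Real.exp (α * (s - r)) * (P s * y s + Q s * z s) := by
  have hα : 0 ≤ α := by
    rw [hαdef]
    exact div_nonneg (by linarith [hlam.2]) (sq_nonneg κ)
  have hexp : ∀ t : ℝ,
      HasDerivAt (fun s => Real.exp (α * (s - r))) (Real.exp (α * (t - r)) * α) t := by
    intro t
    simpa using (((hasDerivAt_id t).sub_const r).const_mul α).exp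
  have hexpcont : Continuous fun s => Real.exp (α * (s - r)) := by fun_prop
  set F' : ℝ → ℝ := fun s => Real.exp (α * (s - r)) * ((1 / 2) * w s + α / 2 * y s ^ 2) with hF'
  have hF'cont : ContinuousOn F' (Set.Icc 0 r) :=
    hexpcont.continuousOn.mul ((continuousOn_const.mul hwcont).add
      (continuousOn_const.mul (hycont.pow 2)))
  have hFcont : ContinuousOn (fun s => (1 / 2) * (Real.exp (α * (s - r)) * y s ^ 2))
      (Set.Icc 0 r) :=
    continuousOn_const.mul (hexpcont.continuousOn.mul (hycont.pow 2))
  have hF : ∀ t ∈ Set.Ioo 0 r,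
      HasDerivAt (fun s => (1 / 2) * (Real.exp (α * (s - r)) * y s ^ 2)) (F' t) t := by
    intro t ht
    have h1 := (hw t (Ioo_subset_Icc_self ht)).hasDerivAt (Icc_mem_nhds ht.1 ht.2)
    refine (((hexp t).mul h1).const_mul (1 / 2)).congr_deriv ?_
    simp only [hF']
    ring
  have hftc := intervalIntegral.integral_eq_sub_of_hasDerivAt_of_le hr.le hFcont hF
    (hF'cont.intervalIntegrable_of_Icc hr.le)
  rw [intervalIntegral.integral_of_le hr.le, integral_Ioc_eq_integral_Ioo] at hftc
  have hF'int : IntegrableOn F' (Set.Ioo 0 r) :=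
    (hF'cont.integrableOn_Icc).mono_set Ioo_subset_Icc_self
  have hPQint : IntegrableOn
      (fun s => Real.exp (α * (s - r)) * (P s * y s + Q s * z s)) (Set.Ioo 0 r) := by
    simp only [mul_add]
    exact hint2.add hint3
  have hmono : ∫ s in Set.Ioo 0 r, (F' s + lam * (Real.exp (α * (s - r)) * z s ^ 2)) ≤
      ∫ s in Set.Ioo 0 r, Real.exp (α * (s - r)) * (P s * y s + Q s * z s) := by
    refine integral_mono_ae (hF'int.add (hint1.const_mul lam)) hPQint ?_
    filter_upwards [hode, ae_restrict_mem measurableSet_Ioo] with t hode_t ht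
    have ht' := Ioo_subset_Icc_self ht
    have hsq : y t ^ 2 ≤ κ ^ 2 * z t ^ 2 := by
      rw [← mul_pow]
      exact pow_le_pow_left₀ (hynn t ht') (hyz t ht') 2
    have habsorb : α / 2 * y t ^ 2 ≤ (1 - lam) * z t ^ 2 := by
      calc α / 2 * y t ^ 2 ≤ α / 2 * (κ ^ 2 * z t ^ 2) := by gcongr
        _ = (1 - lam) * z t ^ 2 := by
          rw [hαdef]
          field_simp
    calc F' t + lam * (Real.exp (α * (t - r)) * z t ^ 2)
        = Real.exp (α * (t - r)) * ((1 / 2) * w t + α / 2 * y t ^ 2 + lam * z t ^ 2) := by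
          simp only [hF']
          ring
      _ ≤ Real.exp (α * (t - r)) * (P t * y t + Q t * z t) :=
          mul_le_mul_of_nonneg_left (by linarith) (Real.exp_pos _).le
  rw [integral_add hF'int (hint1.const_mul lam), integral_const_mul, hftc] at hmono
  have hinit : Real.exp (α * (0 - r)) * y 0 ^ 2 ≤ y 0 ^ 2 := by
    refine mul_le_of_le_one_left (sq_nonneg _) (Real.exp_le_one_iff.2 ?_)
    nlinarith
  simp only [sub_self, mul_zero, Real.exp_zero, one_mul] at hmono
  linarith
end
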